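/- arXiv:1007.2392 — 5 statements merged into one kernel-verified Lean document; each statement's English description precedes it below -/
import Mathlib

section
/- Let η be a solution of the modified Squire equation with wave speed c, and suppose η is not identically zero on [-1,1]. Then min_{y∈[-1,1]} U(y) ≤ Re(c) ≤ max_{y∈[-1,1]} U(y), and Im(c) ≤ −p·(π²/4 + k²)/(α·Re); in particular Im(c) < 0, i.e. all Squire modes are damped. -/
open Real

/-- Wirtinger's inequality on `[-1,1]` with the non-sharp constant `a ^ 2`, `a < π / 2`. -/
lemma sq_mul_integral_sq_le {f f' : ℝ → ℝ} (hf : ∀ y, HasDerivAt f (f' y) y)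
    (hf' : Continuous f') (h1 : f (-1) = 0) (h2 : f 1 = 0) {a : ℝ} (ha0 : 0 ≤ a)
    (ha : a < π / 2) :
    a ^ 2 * ∫ y in (-1 : ℝ)..1, f y ^ 2 ≤ ∫ y in (-1 : ℝ)..1, f' y ^ 2 := by
  have hfc : Continuous f := continuous_iff_continuousAt.2 fun y => (hf y).continuousAt
  have hu : Set.uIcc (-1 : ℝ) 1 = Set.Icc (-1) 1 := Set.uIcc_of_le (by norm_num)
  have hcos : ∀ y ∈ Set.Icc (-1 : ℝ) 1, cos (a * y) ≠ 0 := fun y hy =>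
    (cos_pos_of_mem_Ioo ⟨by nlinarith [hy.1, hy.2], by nlinarith [hy.1, hy.2]⟩).ne'
  have htan : ContinuousOn (fun y => tan (a * y)) (Set.Icc (-1 : ℝ) 1) := fun y hy =>
    ((continuousAt_tan.2 (hcos y hy)).comp (by fun_prop : ContinuousAt (fun y => a * y) y)
      ).continuousWithinAt
  have hd : ∀ y ∈ Set.uIcc (-1 : ℝ) 1, HasDerivAt (fun y => a * tan (a * y) * f y ^ 2)
      (a ^ 2 * (1 + tan (a * y) ^ 2) * f y ^ 2 + 2 * a * tan (a * y) * f y * f' y) y := by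
    intro y hy
    have hc := hcos y (hu ▸ hy)
    have ht := (hasDerivAt_tan hc).comp y ((hasDerivAt_id y).const_mul a)
    refine ((ht.const_mul a).mul ((hf y).pow 2)).congr_deriv ?_
    have h3 : 1 / cos (a * y) ^ 2 = 1 + tan (a * y) ^ 2 := by
      rw [one_div, ← inv_one_add_tan_sq hc, inv_inv]
    simp only [Function.comp, h3, Pi.pow_apply]
    push_cast
    ring
  have hint : IntervalIntegrable
      (fun y => a ^ 2 * (1 + tan (a * y) ^ 2) * f y ^ 2 + 2 * a * tan (a * y) * f y * f' y)
      MeasureTheory.volume (-1) 1 := by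
    apply ContinuousOn.intervalIntegrable
    rw [hu]
    have := hfc.continuousOn (s := Set.Icc (-1 : ℝ) 1)
    have := hf'.continuousOn (s := Set.Icc (-1 : ℝ) 1)
    fun_prop
  have hz := intervalIntegral.integral_eq_sub_of_hasDerivAt hd hint
  have i1 : IntervalIntegrable (fun y => f' y ^ 2) MeasureTheory.volume (-1) 1 :=
    (hf'.pow 2).intervalIntegrable _ _
  rw [← intervalIntegral.integral_const_mul]
  have hle := intervalIntegral.integral_mono_on (by norm_num : (-1 : ℝ) ≤ 1)
    (((hfc.pow 2).const_mul (a ^ 2)).intervalIntegrable _ _) (i1.add hint)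
    (fun y _ => by
      show a ^ 2 * f y ^ 2 ≤ f' y ^ 2 + (a ^ 2 * (1 + tan (a * y) ^ 2) * f y ^ 2
        + 2 * a * tan (a * y) * f y * f' y)
      nlinarith [sq_nonneg (f' y + a * tan (a * y) * f y)])
  rw [intervalIntegral.integral_add i1 hint, hz] at hle
  simpa [h1, h2] using hle

/-- Wirtinger's inequality on `[-1,1]` for functions vanishing at the end points. -/
lemma pi_sq_div_four_mul_integral_sq_le {f f' : ℝ → ℝ} (hf : ∀ y, HasDerivAt f (f' y) y)
    (hf' : Continuous f') (h1 : f (-1) = 0) (h2 : f 1 = 0) :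
    π ^ 2 / 4 * ∫ y in (-1 : ℝ)..1, f y ^ 2 ≤ ∫ y in (-1 : ℝ)..1, f' y ^ 2 := by
  have hc : ContinuousWithinAt (fun a : ℝ => a ^ 2 * ∫ y in (-1 : ℝ)..1, f y ^ 2)
      (Set.Iio (π / 2)) (π / 2) := by fun_prop
  have := le_of_tendsto hc (b := ∫ y in (-1 : ℝ)..1, f' y ^ 2) (by
    filter_upwards [Ioo_mem_nhdsLT (show (0 : ℝ) < π / 2 by positivity)] with a ha
    exact sq_mul_integral_sq_le hf hf' h1 h2 ha.1.le ha.2)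
  linarith [show (π / 2) ^ 2 = π ^ 2 / 4 by ring]

/-- **Damped Squire modes.**
If `η`, not identically zero on `[-1,1]`, solves the modified Squire equation with
wave speed `c`, then `Umin ≤ Re c ≤ Umax` and
`Im c ≤ -p (π²/4 + k²)/(α Re)`; in particular all Squire modes are damped. -/
theorem squire_modes_damped
    (U μ μt : ℝ → ℝ) (η : ℝ → ℂ) (c : ℂ) (α β Re p Umin Umax : ℝ)
    (hU : ContDiff ℝ 1 U) (hμ : ContDiff ℝ 1 μ) (hμt : ContDiff ℝ 1 μt)
    (hη : ContDiff ℝ 2 η)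
    (hα : 0 < α) (hβ : 0 ≤ β) (hRe : 0 < Re)
    (hp : IsLeast (μt '' Set.Icc (-1 : ℝ) 1) p) (hppos : 0 < p)
    (hμtμ : ∀ y ∈ Set.Icc (-1 : ℝ) 1, μt y ≤ μ y)
    (hUmin : IsLeast (U '' Set.Icc (-1 : ℝ) 1) Umin)
    (hUmax : IsGreatest (U '' Set.Icc (-1 : ℝ) 1) Umax)
    (hbc1 : η (-1) = 0) (hbc2 : η 1 = 0)
    (hne : ∃ y ∈ Set.Icc (-1 : ℝ) 1, η y ≠ 0)
    (heq : ∀ y ∈ Set.Icc (-1 : ℝ) 1,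
      c * η y = (U y : ℂ) * η y + (Complex.I / ((α : ℂ) * (Re : ℂ))) *
        ((μ y : ℂ) * (deriv (deriv η) y - ((α ^ 2 + β ^ 2 : ℝ) : ℂ) * η y)
          + ((deriv μ y : ℝ) : ℂ) * deriv η y
          + ((β ^ 2 / (α ^ 2 + β ^ 2) : ℝ) : ℂ) *
              deriv (fun z => ((μt z - μ z : ℝ) : ℂ) * deriv η z) y)) :
    (Umin ≤ c.re ∧ c.re ≤ Umax) ∧
      c.im ≤ -p * (π ^ 2 / 4 + (α ^ 2 + β ^ 2)) / (α * Re) := by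
  set k2 : ℝ := α ^ 2 + β ^ 2 with hk2
  set γ : ℝ := β ^ 2 / k2 with hγ
  have hk2pos : 0 < k2 := by positivity
  have hγ0 : 0 ≤ γ := by positivity
  have hγ1 : γ ≤ 1 := by rw [hγ, div_le_one hk2pos]; nlinarith [sq_nonneg α]
  have hη1 : ContDiff ℝ 1 (deriv η) := hη.deriv' (n := 1)
  have dη : ∀ y, HasDerivAt η (deriv η y) y := fun y =>
    (hη.differentiable (by norm_num) y).hasDerivAt
  have dη' : ∀ y, HasDerivAt (deriv η) (deriv (deriv η) y) y := fun y =>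
    (hη1.differentiable (by norm_num) y).hasDerivAt
  have dμ : ∀ y, HasDerivAt μ (deriv μ y) y := fun y =>
    (hμ.differentiable (by norm_num) y).hasDerivAt
  have dμt : ∀ y, HasDerivAt μt (deriv μt y) y := fun y =>
    (hμt.differentiable (by norm_num) y).hasDerivAt
  have cη := hη.continuous
  have cη1 := hη1.continuous
  have cη2 : Continuous (deriv (deriv η)) := hη1.continuous_deriv (by norm_num)
  have cμ := hμ.continuous
  have cμt := hμt.continuous
  have cμ' : Continuous (deriv μ) := hμ.continuous_deriv (by norm_num)
  have cμt' : Continuous (deriv μt) := hμt.continuous_deriv (by norm_num)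
  have cU := hU.continuous
  have dre : ∀ {h : ℝ → ℂ} {h' : ℂ} {y : ℝ}, HasDerivAt h h' y →
      HasDerivAt (fun z => (h z).re) h'.re y := fun {_ _ y} hh =>
    Complex.reCLM.hasFDerivAt.comp_hasDerivAt y hh
  have dim : ∀ {h : ℝ → ℂ} {h' : ℂ} {y : ℝ}, HasDerivAt h h' y →
      HasDerivAt (fun z => (h z).im) h'.im y := fun {_ _ y} hh =>
    Complex.imCLM.hasFDerivAt.comp_hasDerivAt y hh
  obtain ⟨f, hf⟩ : ∃ f : ℝ → ℝ, f = fun y => (η y).re := ⟨_, rfl⟩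
  obtain ⟨g, hg⟩ : ∃ g : ℝ → ℝ, g = fun y => (η y).im := ⟨_, rfl⟩
  obtain ⟨f1, hf1⟩ : ∃ f : ℝ → ℝ, f = fun y => (deriv η y).re := ⟨_, rfl⟩
  obtain ⟨g1, hg1⟩ : ∃ g : ℝ → ℝ, g = fun y => (deriv η y).im := ⟨_, rfl⟩
  obtain ⟨f2, hf2⟩ : ∃ f : ℝ → ℝ, f = fun y => (deriv (deriv η) y).re := ⟨_, rfl⟩
  obtain ⟨g2, hg2⟩ : ∃ g : ℝ → ℝ, g = fun y => (deriv (deriv η) y).im := ⟨_, rfl⟩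
  obtain ⟨ν, hν⟩ : ∃ ν : ℝ → ℝ, ν = fun y => μ y + γ * (μt y - μ y) := ⟨_, rfl⟩
  obtain ⟨ν1, hν1⟩ : ∃ ν : ℝ → ℝ, ν = fun y => deriv μ y + γ * (deriv μt y - deriv μ y) :=
    ⟨_, rfl⟩
  have cf : Continuous f := by rw [hf]; fun_prop
  have cg : Continuous g := by rw [hg]; fun_prop
  have cf1 : Continuous f1 := by rw [hf1]; fun_prop
  have cg1 : Continuous g1 := by rw [hg1]; fun_prop
  have cf2 : Continuous f2 := by rw [hf2]; fun_prop
  have cg2 : Continuous g2 := by rw [hg2]; fun_prop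
  have cν : Continuous ν := by rw [hν]; fun_prop
  have cν1 : Continuous ν1 := by rw [hν1]; fun_prop
  have df : ∀ y, HasDerivAt f (f1 y) y := fun y => by rw [hf, hf1]; exact dre (dη y)
  have dg : ∀ y, HasDerivAt g (g1 y) y := fun y => by rw [hg, hg1]; exact dim (dη y)
  have df1 : ∀ y, HasDerivAt f1 (f2 y) y := fun y => by rw [hf1, hf2]; exact dre (dη' y)
  have dg1 : ∀ y, HasDerivAt g1 (g2 y) y := fun y => by rw [hg1, hg2]; exact dim (dη' y)
  have dν : ∀ y, HasDerivAt ν (ν1 y) y := fun y => by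
    rw [hν, hν1]; exact (dμ y).add (((dμt y).sub (dμ y)).const_mul γ)
  have hαR : 0 < α * Re := by positivity
  have key : ∀ y ∈ Set.Icc (-1 : ℝ) 1,
      α * Re * (c.re * f y - c.im * g y)
          = α * Re * (U y * f y) - (ν y * g2 y + ν1 y * g1 y - k2 * μ y * g y) ∧
        α * Re * (c.re * g y + c.im * f y)
          = α * Re * (U y * g y) + (ν y * f2 y + ν1 y * f1 y - k2 * μ y * f y) := by
    intro y hy
    have hd : deriv (fun z => ((μt z - μ z : ℝ) : ℂ) * deriv η z) y
        = ((deriv μt y - deriv μ y : ℝ) : ℂ) * deriv η y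
          + ((μt y - μ y : ℝ) : ℂ) * deriv (deriv η) y :=
      ((((dμt y).sub (dμ y)).ofReal_comp).mul (dη' y)).deriv
    have h := heq y hy
    rw [hd] at h
    have hαRc : ((α * Re : ℝ) : ℂ) ≠ 0 := by exact_mod_cast hαR.ne'
    have h' : ((α * Re : ℝ) : ℂ) * (c * η y) = ((α * Re : ℝ) : ℂ) * ((U y : ℂ) * η y)
        + Complex.I * ((μ y : ℂ) * (deriv (deriv η) y - ((k2 : ℝ) : ℂ) * η y)
          + ((deriv μ y : ℝ) : ℂ) * deriv η y
          + (γ : ℂ) * (((deriv μt y - deriv μ y : ℝ) : ℂ) * deriv η y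
          + ((μt y - μ y : ℝ) : ℂ) * deriv (deriv η) y)) := by
      rw [h, mul_add, ← mul_assoc _ (Complex.I / _), ← Complex.ofReal_mul,
        mul_div_cancel₀ _ hαRc]
    have hr := congrArg Complex.re h'
    have hi := congrArg Complex.im h'
    simp only [Complex.add_re, Complex.add_im, Complex.mul_re, Complex.mul_im, Complex.sub_re,
      Complex.sub_im, Complex.ofReal_re, Complex.ofReal_im, Complex.I_re, Complex.I_im] at hr hi
    subst hf hg hf1 hg1 hf2 hg2 hν hν1
    constructor
    · linear_combination hr
    · linear_combination hi
  have hf_left : f (-1) = 0 := by simp [hf, hbc1]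
  have hf_right : f 1 = 0 := by simp [hf, hbc2]
  have hg_left : g (-1) = 0 := by simp [hg, hbc1]
  have hg_right : g 1 = 0 := by simp [hg, hbc2]
  have hu : Set.uIcc (-1 : ℝ) 1 = Set.Icc (-1) 1 := Set.uIcc_of_le (by norm_num)
  have h11 : (-1 : ℝ) ≤ 1 := by norm_num
  have hN : 0 < ∫ y in (-1 : ℝ)..1, (f y ^ 2 + g y ^ 2) := by
    obtain ⟨y, hy, hy0⟩ := hne
    refine intervalIntegral.integral_pos (by norm_num) (by fun_prop)
      (fun _ _ => by positivity) ⟨y, hy, ?_⟩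
    have := Complex.normSq_pos.2 hy0
    rw [Complex.normSq_apply] at this
    subst hf hg
    simp only
    nlinarith
  -- The real part of the wave speed is the average of `U` with weight `‖η‖²`.
  have hre : c.re * ∫ y in (-1 : ℝ)..1, (f y ^ 2 + g y ^ 2)
      = ∫ y in (-1 : ℝ)..1, U y * (f y ^ 2 + g y ^ 2) := by
    have hz := intervalIntegral.integral_eq_sub_of_hasDerivAt (a := -1) (b := 1)
      (fun y _ => (dν y).mul (((df y).mul (dg1 y)).sub ((dg y).mul (df1 y))))
      (Continuous.intervalIntegrable (by fun_prop) _ _)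
    simp only [Pi.mul_apply, Pi.sub_apply, hf_left, hf_right, hg_left, hg_right, zero_mul,
      sub_self, mul_zero] at hz
    rw [intervalIntegral.integral_congr (g := fun y =>
      α * Re * (U y * (f y ^ 2 + g y ^ 2)) - α * Re * (c.re * (f y ^ 2 + g y ^ 2))) ?_,
      intervalIntegral.integral_sub (Continuous.intervalIntegrable (by fun_prop) _ _)
        (Continuous.intervalIntegrable (by fun_prop) _ _)] at hz
    · simp only [intervalIntegral.integral_const_mul] at hz ⊢
      have := mul_left_cancel₀ hαR.ne' (sub_eq_zero.1 hz)
      exact this.symm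
    · intro y hy
      obtain ⟨e1, e2⟩ := key y (hu ▸ hy)
      simp only
      linear_combination f y * e1 + g y * e2
  -- The energy inequality for the imaginary part.
  have him : α * Re * c.im * ∫ y in (-1 : ℝ)..1, (f y ^ 2 + g y ^ 2)
      ≤ -p * (∫ y in (-1 : ℝ)..1, (f1 y ^ 2 + g1 y ^ 2))
        - p * k2 * ∫ y in (-1 : ℝ)..1, (f y ^ 2 + g y ^ 2) := by
    have hi : IntervalIntegrable (fun y => ν1 y * (f y * f1 y + g y * g1 y)
        + ν y * (f1 y * f1 y + f y * f2 y + (g1 y * g1 y + g y * g2 y)))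
        MeasureTheory.volume (-1) 1 := Continuous.intervalIntegrable (by fun_prop) _ _
    have hz := intervalIntegral.integral_eq_sub_of_hasDerivAt
      (fun y _ => (dν y).mul (((df y).mul (df1 y)).add ((dg y).mul (dg1 y)))) hi
    simp only [Pi.mul_apply, Pi.add_apply, hf_left, hf_right, hg_left, hg_right, zero_mul,
      add_zero, mul_zero, sub_self] at hz
    have hle := intervalIntegral.integral_mono_on h11
      (μ := MeasureTheory.volume)
      (f := fun y => α * Re * c.im * (f y ^ 2 + g y ^ 2))
      (g := fun y => (ν1 y * (f y * f1 y + g y * g1 y)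
          + ν y * (f1 y * f1 y + f y * f2 y + (g1 y * g1 y + g y * g2 y)))
        + (-p * (f1 y ^ 2 + g1 y ^ 2) - p * k2 * (f y ^ 2 + g y ^ 2)))
      (Continuous.intervalIntegrable (by fun_prop) _ _)
      (Continuous.intervalIntegrable (by fun_prop) _ _) (by
        intro y hy
        obtain ⟨e1, e2⟩ := key y hy
        have hpt : p ≤ μt y := hp.2 ⟨y, hy, rfl⟩
        have hμy := hμtμ y hy
        have hνy : p ≤ ν y := by
          rw [hν]
          simp only
          nlinarith
        have hA : 0 ≤ (ν y - p) * (f1 y ^ 2 + g1 y ^ 2) :=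
          mul_nonneg (by linarith) (by positivity)
        have hB : 0 ≤ k2 * (μ y - p) * (f y ^ 2 + g y ^ 2) :=
          mul_nonneg (mul_nonneg hk2pos.le (by linarith)) (by positivity)
        have hE : α * Re * c.im * (f y ^ 2 + g y ^ 2)
            = f y * (ν y * f2 y + ν1 y * f1 y - k2 * μ y * f y)
              + g y * (ν y * g2 y + ν1 y * g1 y - k2 * μ y * g y) := by
          linear_combination f y * e2 - g y * e1
        linarith)
    have i1 : IntervalIntegrable (fun y => -p * (f1 y ^ 2 + g1 y ^ 2))
        MeasureTheory.volume (-1) 1 := Continuous.intervalIntegrable (by fun_prop) _ _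
    have i2 : IntervalIntegrable (fun y => p * k2 * (f y ^ 2 + g y ^ 2))
        MeasureTheory.volume (-1) 1 := Continuous.intervalIntegrable (by fun_prop) _ _
    rw [intervalIntegral.integral_add hi (i1.sub i2), hz,
      intervalIntegral.integral_sub i1 i2] at hle
    simp only [intervalIntegral.integral_const_mul] at hle
    linarith
  have hW : π ^ 2 / 4 * ∫ y in (-1 : ℝ)..1, (f y ^ 2 + g y ^ 2)
      ≤ ∫ y in (-1 : ℝ)..1, (f1 y ^ 2 + g1 y ^ 2) := by
    have isq : ∀ {h : ℝ → ℝ}, Continuous h →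
        IntervalIntegrable (fun y => h y ^ 2) MeasureTheory.volume (-1) 1 :=
      fun hh => (hh.pow 2).intervalIntegrable _ _
    rw [intervalIntegral.integral_add (isq cf) (isq cg),
      intervalIntegral.integral_add (isq cf1) (isq cg1), mul_add]
    exact add_le_add (pi_sq_div_four_mul_integral_sq_le df cf1 hf_left hf_right)
      (pi_sq_div_four_mul_integral_sq_le dg cg1 hg_left hg_right)
  refine ⟨⟨?_, ?_⟩, ?_⟩
  · refine le_of_mul_le_mul_right ?_ hN
    rw [hre, ← intervalIntegral.integral_const_mul]
    refine intervalIntegral.integral_mono_on h11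
      (Continuous.intervalIntegrable (by fun_prop) _ _)
      (Continuous.intervalIntegrable (by fun_prop) _ _) fun y hy => ?_
    exact mul_le_mul_of_nonneg_right (hUmin.2 ⟨y, hy, rfl⟩) (by positivity)
  · refine le_of_mul_le_mul_right ?_ hN
    rw [hre, ← intervalIntegral.integral_const_mul]
    refine intervalIntegral.integral_mono_on h11
      (Continuous.intervalIntegrable (by fun_prop) _ _)
      (Continuous.intervalIntegrable (by fun_prop) _ _) fun y hy => ?_
    exact mul_le_mul_of_nonneg_right (hUmax.2 ⟨y, hy, rfl⟩) (by positivity)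
  · rw [le_div_iff₀ hαR]
    refine le_of_mul_le_mul_right ?_ hN
    nlinarith [mul_le_mul_of_nonneg_left hW hppos.le]
end

section
/- Let v be a solution of the modified Orr–Sommerfeld equation with wave speed c, not identically zero on [-1,1]. Then Im(c) ≤ q/(2α) − (p/(α·Re))·( π²·(π² + α²)/(π² + 4α²) + α² ). -/
open Real

/-- Picone-type inequality with weight `k tan (k (x - m))`. -/
lemma tan_boundary_le_integral {g g' : ℝ → ℝ} {l r k m : ℝ} (hlr : l ≤ r)
    (hg : ∀ x, HasDerivAt g (g' x) x) (hg' : Continuous g')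
    (hk : ∀ x ∈ Set.Icc l r, |k * (x - m)| < π / 2) :
    k * tan (k * (l - m)) * g l ^ 2 - k * tan (k * (r - m)) * g r ^ 2
      ≤ ∫ x in l..r, (g' x ^ 2 - k ^ 2 * g x ^ 2) := by
  have hgc : Continuous g := continuous_iff_continuousAt.2 fun x => (hg x).continuousAt
  have hcos : ∀ x ∈ Set.Icc l r, 0 < cos (k * (x - m)) := fun x hx =>
    cos_pos_of_mem_Ioo (abs_lt.1 (hk x hx))
  have hd : ∀ x ∈ Set.Icc l r, HasDerivAt (fun x => -(k * tan (k * (x - m)) * g x ^ 2))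
      (-(k * (1 / cos (k * (x - m)) ^ 2 * k) * g x ^ 2
        + k * tan (k * (x - m)) * (2 * g x * g' x))) x := by
    intro x hx
    have h1 : HasDerivAt (fun x => k * (x - m)) k x := by
      simpa using ((hasDerivAt_id x).sub_const m).const_mul k
    have h2 := (hasDerivAt_tan (hcos x hx).ne').comp x h1
    have h3 := ((h2.const_mul k).mul ((hg x).pow 2)).neg
    refine HasDerivAt.congr_deriv h3 ?_
    simp
  have key := intervalIntegral.sub_le_integral_of_hasDeriv_right_of_le
    (φ := fun x => g' x ^ 2 - k ^ 2 * g x ^ 2) hlr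
    (fun x hx => (hd x hx).continuousAt.continuousWithinAt)
    (fun x hx => (hd x (Set.Ioo_subset_Icc_self hx)).hasDerivWithinAt)
    (by apply Continuous.integrableOn_Icc; fun_prop)
    (by
      intro x hx
      have hc := hcos x (Set.Ioo_subset_Icc_self hx)
      have hsec : 1 / cos (k * (x - m)) ^ 2 = 1 + tan (k * (x - m)) ^ 2 := by
        rw [← inv_one_add_tan_sq hc.ne']; simp
      rw [hsec]
      nlinarith [sq_nonneg (g' x + k * tan (k * (x - m)) * g x)])
  linarith

lemma sq_mul_le_of_forall_lt {A B K : ℝ} (hK : 0 < K)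
    (h : ∀ k, 0 < k → k < K → k ^ 2 * B ≤ A) : K ^ 2 * B ≤ A := by
  have ht : Filter.Tendsto (fun k : ℝ => k ^ 2 * B) (nhdsWithin K (Set.Iio K))
      (nhds (K ^ 2 * B)) :=
    (Continuous.tendsto (by fun_prop) K).mono_left nhdsWithin_le_nhds
  refine le_of_tendsto ht ?_
  filter_upwards [Ioo_mem_nhdsLT hK] with k hk using h k hk.1 hk.2

/-- Poincaré inequality on `[-1,1]` with Dirichlet boundary conditions. -/
lemma poincare_dirichlet {g g' : ℝ → ℝ}
    (hg : ∀ x, HasDerivAt g (g' x) x) (hg' : Continuous g') (h0 : g (-1) = 0) (h1 : g 1 = 0) :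
    (π / 2) ^ 2 * ∫ x in (-1 : ℝ)..1, g x ^ 2 ≤ ∫ x in (-1 : ℝ)..1, g' x ^ 2 := by
  have hgc : Continuous g := continuous_iff_continuousAt.2 fun x => (hg x).continuousAt
  refine sq_mul_le_of_forall_lt (by positivity) fun k hk0 hk => ?_
  have h := tan_boundary_le_integral (l := -1) (r := 1) (k := k) (m := 0) (by norm_num) hg hg' (by
    intro x hx
    rw [sub_zero, abs_mul, abs_of_pos hk0]
    have : |x| ≤ 1 := abs_le.2 hx
    nlinarith)
  rw [intervalIntegral.integral_sub (Continuous.intervalIntegrable (by fun_prop) _ _)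
    (Continuous.intervalIntegrable (by fun_prop) _ _), intervalIntegral.integral_const_mul,
    h0, h1] at h
  linarith

/-- Wirtinger inequality on `[-1,1]` for mean-zero functions vanishing at both endpoints. -/
lemma wirtinger_dirichlet {w w' : ℝ → ℝ}
    (hw : ∀ x, HasDerivAt w (w' x) x) (hw' : Continuous w') (h0 : w (-1) = 0) (h1 : w 1 = 0)
    (hmean : ∫ x in (-1 : ℝ)..1, w x = 0) :
    π ^ 2 * ∫ x in (-1 : ℝ)..1, w x ^ 2 ≤ ∫ x in (-1 : ℝ)..1, w' x ^ 2 := by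
  have hwc : Continuous w := continuous_iff_continuousAt.2 fun x => (hw x).continuousAt
  obtain ⟨x₀, hx₀, hx⟩ : ∃ x₀ ∈ Set.Icc (-1 : ℝ) 0, w (x₀ + 1) = w x₀ := by
    have hf : ContinuousOn (fun x => w (x + 1) - w x) (Set.uIcc (-1 : ℝ) 0) := by fun_prop
    have h := intermediate_value_uIcc hf
    have hz : (0 : ℝ) ∈ Set.uIcc (w (-1 + 1) - w (-1)) (w (0 + 1) - w 0) := by
      rw [Set.mem_uIcc]
      norm_num [h0, h1]
      exact (le_total _ _).symm
    obtain ⟨x, hx, hxe⟩ := h hz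
    rw [Set.uIcc_of_le (by norm_num)] at hx
    exact ⟨x, hx, sub_eq_zero.1 hxe⟩
  obtain ⟨hl, hr⟩ := hx₀
  refine sq_mul_le_of_forall_lt pi_pos fun k hk0 hk => ?_
  have hg : ∀ x, HasDerivAt (fun x => w x - w x₀) (w' x) x := fun x => (hw x).sub_const _
  have bd : ∀ m x : ℝ, m - 1 / 2 ≤ x → x ≤ m + 1 / 2 → |k * (x - m)| < π / 2 := by
    intro m x h1 h2
    rw [abs_mul, abs_of_pos hk0]
    have : |x - m| ≤ 1 / 2 := abs_le.2 ⟨by linarith, by linarith⟩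
    nlinarith
  have i1 := tan_boundary_le_integral (l := -1) (r := x₀) (k := k) (m := x₀ - 1 / 2) hl hg hw'
    (fun x hx => bd _ _ (by linarith [hx.1]) (by linarith [hx.2]))
  have i2 := tan_boundary_le_integral (l := x₀) (r := x₀ + 1) (k := k) (m := x₀ + 1 / 2)
    (by linarith) hg hw' (fun x hx => bd _ _ (by linarith [hx.1]) (by linarith [hx.2]))
  have i3 := tan_boundary_le_integral (l := x₀ + 1) (r := 1) (k := k) (m := x₀ + 3 / 2)
    (by linarith) hg hw' (fun x hx => bd _ _ (by linarith [hx.1]) (by linarith [hx.2]))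
  have hint : ∀ a b : ℝ, IntervalIntegrable (fun x => w' x ^ 2 - k ^ 2 * (w x - w x₀) ^ 2)
      MeasureTheory.volume a b := fun a b => Continuous.intervalIntegrable (by fun_prop) _ _
  have hsum := intervalIntegral.integral_add_adjacent_intervals (hint (-1) x₀) (hint x₀ (x₀ + 1))
  have hsum' := intervalIntegral.integral_add_adjacent_intervals (hint (-1) (x₀ + 1))
    (hint (x₀ + 1) 1)
  have e : (1 : ℝ) - (x₀ + 3 / 2) = -1 - (x₀ - 1 / 2) := by ring
  simp only [hx, h0, h1, sub_self, e] at i1 i2 i3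
  have hexp : ∫ x in (-1 : ℝ)..1, (w' x ^ 2 - k ^ 2 * (w x - w x₀) ^ 2)
      = (∫ x in (-1 : ℝ)..1, w' x ^ 2) - k ^ 2 * (∫ x in (-1 : ℝ)..1, w x ^ 2)
        - 2 * k ^ 2 * w x₀ ^ 2 := by
    have : ∀ x, w' x ^ 2 - k ^ 2 * (w x - w x₀) ^ 2
        = w' x ^ 2 - k ^ 2 * w x ^ 2 + 2 * k ^ 2 * w x₀ * w x - k ^ 2 * w x₀ ^ 2 := fun x => by ring
    simp only [this]
    rw [intervalIntegral.integral_sub, intervalIntegral.integral_add, intervalIntegral.integral_sub,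
      intervalIntegral.integral_const_mul, intervalIntegral.integral_const_mul, hmean,
      intervalIntegral.integral_const]
    · simp; ring
    all_goals exact Continuous.intervalIntegrable (by fun_prop) _ _
  nlinarith [mul_nonneg (sq_nonneg k) (sq_nonneg (w x₀))]

/-- The Poincaré and Wirtinger inequalities combined for clamped functions. -/
lemma clamped_poincare {a a' a'' : ℝ → ℝ} (ha : ∀ x, HasDerivAt a (a' x) x)
    (ha' : ∀ x, HasDerivAt a' (a'' x) x) (hc : Continuous a'')
    (h1 : a (-1) = 0) (h2 : a 1 = 0) (h3 : a' (-1) = 0) (h4 : a' 1 = 0) :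
    (π / 2) ^ 2 * (∫ x in (-1 : ℝ)..1, a x ^ 2) ≤ (∫ x in (-1 : ℝ)..1, a' x ^ 2) ∧
    π ^ 2 * (∫ x in (-1 : ℝ)..1, a' x ^ 2) ≤ ∫ x in (-1 : ℝ)..1, a'' x ^ 2 := by
  have hc' : Continuous a' := continuous_iff_continuousAt.2 fun x => (ha' x).continuousAt
  refine ⟨poincare_dirichlet ha hc' h1 h2, wirtinger_dirichlet ha' hc h3 h4 ?_⟩
  rw [intervalIntegral.integral_eq_sub_of_hasDerivAt (fun x _ => ha x)
    (hc'.intervalIntegrable _ _), h1, h2, sub_zero]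

lemma HasDerivAt.complex_re {f : ℝ → ℂ} {f' : ℂ} {x : ℝ} (h : HasDerivAt f f' x) :
    HasDerivAt (fun y => (f y).re) f'.re x :=
  Complex.reCLM.hasFDerivAt.comp_hasDerivAt x h

lemma HasDerivAt.complex_im {f : ℝ → ℂ} {f' : ℂ} {x : ℝ} (h : HasDerivAt f f' x) :
    HasDerivAt (fun y => (f y).im) f'.im x :=
  Complex.imCLM.hasFDerivAt.comp_hasDerivAt x h

lemma wavespeed_bound_of_energy {I₀ I₁ I₂ γ α R p q : ℝ} (hα : 0 < α) (hR : 0 < R) (hp : 0 < p)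
    (hI₀ : 0 < I₀) (h01 : (π / 2) ^ 2 * I₀ ≤ I₁) (h12 : π ^ 2 * I₁ ≤ I₂)
    (h : (α * γ - q / 2) * (I₁ + α ^ 2 * I₀)
      + p / R * (I₂ + 2 * α ^ 2 * I₁ + α ^ 4 * I₀) ≤ 0) :
    γ ≤ q / (2 * α)
      - (p / (α * R)) * (π ^ 2 * (π ^ 2 + α ^ 2) / (π ^ 2 + 4 * α ^ 2) + α ^ 2) := by
  have hπ := pi_pos
  have hI₁ : 0 < I₁ := lt_of_lt_of_le (by positivity) h01
  set K := π ^ 2 * (π ^ 2 + α ^ 2) / (π ^ 2 + 4 * α ^ 2) with hK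
  have hE : 0 < I₁ + α ^ 2 * I₀ := by positivity
  have hKE : K * (I₁ + α ^ 2 * I₀) ≤ I₂ + α ^ 2 * I₁ := by
    have h1 : π ^ 2 * (I₁ + α ^ 2 * I₀) ≤ (π ^ 2 + 4 * α ^ 2) * I₁ := by
      nlinarith [mul_le_mul_of_nonneg_left h01 (sq_nonneg α)]
    rw [hK, div_mul_eq_mul_div, div_le_iff₀ (by positivity)]
    calc π ^ 2 * (π ^ 2 + α ^ 2) * (I₁ + α ^ 2 * I₀)
        = (π ^ 2 + α ^ 2) * (π ^ 2 * (I₁ + α ^ 2 * I₀)) := by ring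
      _ ≤ (π ^ 2 + α ^ 2) * ((π ^ 2 + 4 * α ^ 2) * I₁) := by gcongr
      _ = (π ^ 2 * I₁ + α ^ 2 * I₁) * (π ^ 2 + 4 * α ^ 2) := by ring
      _ ≤ (I₂ + α ^ 2 * I₁) * (π ^ 2 + 4 * α ^ 2) := by gcongr
  have hpR : 0 < p / R := by positivity
  have h2 : (α * γ - q / 2 + p / R * (K + α ^ 2)) * (I₁ + α ^ 2 * I₀) ≤ 0 := by
    nlinarith [mul_le_mul_of_nonneg_left hKE hpR.le]
  have h3 : α * γ - q / 2 + p / R * (K + α ^ 2) ≤ 0 := nonpos_of_mul_nonpos_left h2 hE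
  have h4 : q / (2 * α) - (p / (α * R)) * (K + α ^ 2)
      = (q / 2 - p / R * (K + α ^ 2)) / α := by
    field_simp
  rw [h4, le_div_iff₀ hα]
  linarith

/-- **Growth-rate bound for the modified Orr–Sommerfeld equation.**
If `v`, not identically zero on `[-1,1]`, solves the modified Orr–Sommerfeld
equation with wave speed `c`, then
`Im c ≤ q/(2α) − (p/(α Re)) (π²(π²+α²)/(π²+4α²) + α²)`. -/
theorem orr_sommerfeld_imag_bound
    (U μ μt : ℝ → ℝ) (v : ℝ → ℂ) (c : ℂ) (α Re p q : ℝ)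
    (hU : ContDiff ℝ 2 U) (hμ : ContDiff ℝ 1 μ) (hμt : ContDiff ℝ 2 μt)
    (hv : ContDiff ℝ 4 v)
    (hα : 0 < α) (hRe : 0 < Re)
    (hq : IsGreatest ((fun y => |deriv U y|) '' Set.Icc (-1 : ℝ) 1) q)
    (hp : IsLeast (μt '' Set.Icc (-1 : ℝ) 1) p) (hppos : 0 < p)
    (hμtμ : ∀ y ∈ Set.Icc (-1 : ℝ) 1, μt y ≤ μ y)
    (hbc1 : v (-1) = 0) (hbc2 : v 1 = 0)
    (hbc3 : deriv v (-1) = 0) (hbc4 : deriv v 1 = 0)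
    (hne : ∃ y ∈ Set.Icc (-1 : ℝ) 1, v y ≠ 0)
    (heq : ∀ y ∈ Set.Icc (-1 : ℝ) 1,
      (α : ℂ) * c * (deriv (deriv v) y - (α : ℂ) ^ 2 * v y)
        = (α : ℂ) * ((U y : ℂ) * (deriv (deriv v) y - (α : ℂ) ^ 2 * v y)
            - ((deriv (deriv U) y : ℝ) : ℂ) * v y)
          - (4 * Complex.I * (α : ℂ) ^ 2 / (Re : ℂ)) *
              deriv (fun z => ((μ z : ℝ) : ℂ) * deriv v z) y
          + (Complex.I / (Re : ℂ)) *
              (deriv (deriv (fun z => ((μt z : ℝ) : ℂ) *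
                  (deriv (deriv v) z + (α : ℂ) ^ 2 * v z))) y
                + (α : ℂ) ^ 2 * ((μt y : ℝ) : ℂ) *
                    (deriv (deriv v) y + (α : ℂ) ^ 2 * v y))) :
    c.im ≤ q / (2 * α)
      - (p / (α * Re)) * (π ^ 2 * (π ^ 2 + α ^ 2) / (π ^ 2 + 4 * α ^ 2) + α ^ 2) := by
  set v₁ := deriv v with hv₁
  set v₂ := deriv v₁ with hv₂
  have cv₁ : ContDiff ℝ 3 v₁ := hv.deriv' (n := 3)
  have cv₂ : ContDiff ℝ 2 v₂ := cv₁.deriv' (n := 2)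
  have dv : ∀ y, HasDerivAt v (v₁ y) y := fun y =>
    (hv.differentiable (by norm_num) y).hasDerivAt
  have dv₁ : ∀ y, HasDerivAt v₁ (v₂ y) y := fun y =>
    (cv₁.differentiable (by norm_num) y).hasDerivAt
  set P : ℝ → ℂ := fun z => ((μt z : ℝ) : ℂ) * (v₂ z + (α : ℂ) ^ 2 * v z) with hP
  set N : ℝ → ℂ := fun z => ((μ z : ℝ) : ℂ) * v₁ z with hN
  have cP : ContDiff ℝ 2 P :=
    (Complex.ofRealCLM.contDiff.comp hμt).mul
      (cv₂.add (contDiff_const.mul (hv.of_le (by norm_num))))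
  have cN : ContDiff ℝ 1 N :=
    (Complex.ofRealCLM.contDiff.comp hμ).mul (cv₁.of_le (by norm_num))
  have cP₁ : ContDiff ℝ 1 (deriv P) := cP.deriv' (n := 1)
  have dP : ∀ y, HasDerivAt P (deriv P y) y := fun y =>
    (cP.differentiable (by norm_num) y).hasDerivAt
  have dP₁ : ∀ y, HasDerivAt (deriv P) (deriv (deriv P) y) y := fun y =>
    (cP₁.differentiable (by norm_num) y).hasDerivAt
  have dN : ∀ y, HasDerivAt N (deriv N y) y := fun y =>
    (cN.differentiable (by norm_num) y).hasDerivAt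
  have dU : ∀ y, HasDerivAt U (deriv U y) y := fun y =>
    (hU.differentiable (by norm_num) y).hasDerivAt
  have Pre : ∀ y, (P y).re = μt y * ((v₂ y).re + α ^ 2 * (v y).re) := fun y => by
    simp [hP, ← Complex.ofReal_pow]
  have Pim : ∀ y, (P y).im = μt y * ((v₂ y).im + α ^ 2 * (v y).im) := fun y => by
    simp [hP, ← Complex.ofReal_pow]
  have Nre : ∀ y, (N y).re = μ y * (v₁ y).re := fun y => by simp [hN]
  have Nim : ∀ y, (N y).im = μ y * (v₁ y).im := fun y => by simp [hN]
  have contv : Continuous v := hv.continuous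
  have contv₁ : Continuous v₁ := cv₁.continuous
  have contv₂ : Continuous v₂ := cv₂.continuous
  obtain ⟨re01, re12⟩ := clamped_poincare (fun y => (dv y).complex_re)
    (fun y => (dv₁ y).complex_re) (by fun_prop) (by simp [hbc1]) (by simp [hbc2])
    (by simp [hbc3]) (by simp [hbc4])
  obtain ⟨im01, im12⟩ := clamped_poincare (fun y => (dv y).complex_im)
    (fun y => (dv₁ y).complex_im) (by fun_prop) (by simp [hbc1]) (by simp [hbc2])
    (by simp [hbc3]) (by simp [hbc4])
  have split : ∀ f : ℝ → ℂ, Continuous f → ∫ y in (-1 : ℝ)..1, Complex.normSq (f y)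
      = (∫ y in (-1 : ℝ)..1, (f y).re ^ 2) + ∫ y in (-1 : ℝ)..1, (f y).im ^ 2 := by
    intro f hf
    rw [← intervalIntegral.integral_add (Continuous.intervalIntegrable (by fun_prop) _ _)
      (Continuous.intervalIntegrable (by fun_prop) _ _)]
    simp only [Complex.normSq_apply, sq]
  have contD : ∀ f : ℝ → ℂ, Continuous f → Continuous fun y => Complex.normSq (f y) :=
    fun f hf => Complex.continuous_normSq.comp hf
  have cD₀ := contD v contv
  have cD₁ := contD v₁ contv₁
  have cD₂ := contD v₂ contv₂
  refine wavespeed_bound_of_energy (I₀ := ∫ y in (-1 : ℝ)..1, Complex.normSq (v y))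
    (I₁ := ∫ y in (-1 : ℝ)..1, Complex.normSq (v₁ y))
    (I₂ := ∫ y in (-1 : ℝ)..1, Complex.normSq (v₂ y)) hα hRe hppos ?_ ?_ ?_ ?_
  · obtain ⟨y, hy, hvy⟩ := hne
    exact intervalIntegral.integral_pos (by norm_num) cD₀.continuousOn
      (fun _ _ => Complex.normSq_nonneg _) ⟨y, hy, Complex.normSq_pos.2 hvy⟩
  · rw [split v contv, split v₁ contv₁, mul_add]; exact add_le_add re01 im01
  · rw [split v₁ contv₁, split v₂ contv₂, mul_add]; exact add_le_add re12 im12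
  have hG : ∀ y, HasDerivAt (fun y =>
      (α * c.im - 2 * α ^ 2 * (p / Re)) * ((v y).re * (v₁ y).re + (v y).im * (v₁ y).im)
      + (α * c.re - α * U y) * ((v y).re * (v₁ y).im - (v y).im * (v₁ y).re)
      + 4 * α ^ 2 / Re * ((v y).re * (N y).re + (v y).im * (N y).im)
      - 1 / Re * ((v y).re * (deriv P y).re - (v₁ y).re * (P y).re
        + ((v y).im * (deriv P y).im - (v₁ y).im * (P y).im)))
      ((α * c.im - 2 * α ^ 2 * (p / Re)) * ((v₁ y).re * (v₁ y).re + (v y).re * (v₂ y).re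
          + ((v₁ y).im * (v₁ y).im + (v y).im * (v₂ y).im))
      + (-(α * deriv U y) * ((v y).re * (v₁ y).im - (v y).im * (v₁ y).re)
        + (α * c.re - α * U y) * ((v₁ y).re * (v₁ y).im + (v y).re * (v₂ y).im
          - ((v₁ y).im * (v₁ y).re + (v y).im * (v₂ y).re)))
      + 4 * α ^ 2 / Re * ((v₁ y).re * (N y).re + (v y).re * (deriv N y).re
          + ((v₁ y).im * (N y).im + (v y).im * (deriv N y).im))
      - 1 / Re * ((v₁ y).re * (deriv P y).re + (v y).re * (deriv (deriv P) y).re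
          - ((v₂ y).re * (P y).re + (v₁ y).re * (deriv P y).re)
        + ((v₁ y).im * (deriv P y).im + (v y).im * (deriv (deriv P) y).im
          - ((v₂ y).im * (P y).im + (v₁ y).im * (deriv P y).im)))) y := by
    intro y
    have a := (dv y).complex_re
    have b := (dv y).complex_im
    have a₁ := (dv₁ y).complex_re
    have b₁ := (dv₁ y).complex_im
    have e := dP y
    have e₁ := dP₁ y
    have n := dN y
    exact (((((a.mul a₁).add (b.mul b₁)).const_mul _).add
      ((((dU y).const_mul α).const_sub _).mul ((a.mul b₁).sub (b.mul a₁)))).add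
      (((a.mul n.complex_re).add (b.mul n.complex_im)).const_mul _)).sub
      ((((a.mul e₁.complex_re).sub (a₁.mul e.complex_re)).add
        ((b.mul e₁.complex_im).sub (b₁.mul e.complex_im))).const_mul _)
  have key := intervalIntegral.integral_le_sub_of_hasDeriv_right_of_le
    (φ := fun y => (α * c.im - q / 2) * (Complex.normSq (v₁ y) + α ^ 2 * Complex.normSq (v y))
      + p / Re * (Complex.normSq (v₂ y) + 2 * α ^ 2 * Complex.normSq (v₁ y)
        + α ^ 4 * Complex.normSq (v y)))
    (a := -1) (b := 1) (by norm_num)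
    (fun y _ => (hG y).continuousAt.continuousWithinAt)
    (fun y _ => (hG y).hasDerivWithinAt)
    (by apply Continuous.integrableOn_Icc; fun_prop)
    (by
      intro y hy'
      have hy := Set.Ioo_subset_Icc_self hy'
      have E := heq y hy
      have hμy := hμtμ y hy
      have hpy : p ≤ μt y := hp.2 ⟨y, hy, rfl⟩
      have hqy : |deriv U y| ≤ q := hq.2 ⟨y, hy, rfl⟩
      have hI : ∀ r : ℝ, 4 * Complex.I * ((r : ℝ) : ℂ) / (Re : ℂ)
          = ((4 * r / Re : ℝ) : ℂ) * Complex.I := fun r => by push_cast; ring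
      have hI' : Complex.I / (Re : ℂ) = ((1 / Re : ℝ) : ℂ) * Complex.I := by push_cast; ring
      rw [← Complex.ofReal_pow, hI, hI'] at E
      have Er := congrArg Complex.re E
      have Ei := congrArg Complex.im E
      simp only [Complex.mul_re, Complex.mul_im, Complex.add_re, Complex.add_im, Complex.sub_re,
        Complex.sub_im, Complex.ofReal_re, Complex.ofReal_im, Complex.I_re, Complex.I_im,
        zero_mul, mul_zero, sub_zero, add_zero, zero_add, zero_sub, mul_one] at Er Ei
      rw [Nre, Nim, Pre, Pim]
      simp only [Complex.normSq_apply]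
      generalize (v y).re = a at *
      generalize (v y).im = b at *
      generalize (v₁ y).re = a₁ at *
      generalize (v₁ y).im = b₁ at *
      generalize (v₂ y).re = a₂ at *
      generalize (v₂ y).im = b₂ at *
      have hshear : deriv U y * (α * (a * b₁ - b * a₁))
          ≤ q * ((a₁ * a₁ + b₁ * b₁ + α ^ 2 * (a * a + b * b)) / 2) := by
        have hW : |α * (a * b₁ - b * a₁)| ≤ (a₁ * a₁ + b₁ * b₁ + α ^ 2 * (a * a + b * b)) / 2 := by
          rw [abs_le]
          constructor
          · nlinarith [sq_nonneg (b₁ + α * a), sq_nonneg (a₁ - α * b)]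
          · nlinarith [sq_nonneg (b₁ - α * a), sq_nonneg (a₁ + α * b)]
        calc _ ≤ |deriv U y * (α * (a * b₁ - b * a₁))| := le_abs_self _
          _ = |deriv U y| * |α * (a * b₁ - b * a₁)| := abs_mul _ _
          _ ≤ _ := mul_le_mul hqy hW (abs_nonneg _) ((abs_nonneg _).trans hqy)
      have hdiss₁ : 4 * α ^ 2 / Re * (a₁ ^ 2 + b₁ ^ 2) * p
          ≤ 4 * α ^ 2 / Re * (a₁ ^ 2 + b₁ ^ 2) * μ y :=
        mul_le_mul_of_nonneg_left (hpy.trans hμy) (by positivity)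
      have hdiss₂ : 1 / Re * ((a₂ + α ^ 2 * a) ^ 2 + (b₂ + α ^ 2 * b) ^ 2) * p
          ≤ 1 / Re * ((a₂ + α ^ 2 * a) ^ 2 + (b₂ + α ^ 2 * b) ^ 2) * μt y :=
        mul_le_mul_of_nonneg_left hpy (by positivity)
      linear_combination hshear + hdiss₁ + hdiss₂ - a * Ei + b * Er)
  simp only [hbc1, hbc2, hbc3, hbc4, Complex.zero_re, Complex.zero_im, zero_mul, mul_zero,
    add_zero, sub_zero] at key
  rw [intervalIntegral.integral_add, intervalIntegral.integral_const_mul,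
    intervalIntegral.integral_add, intervalIntegral.integral_const_mul,
    intervalIntegral.integral_const_mul, intervalIntegral.integral_add,
    intervalIntegral.integral_add, intervalIntegral.integral_const_mul,
    intervalIntegral.integral_const_mul] at key
  · exact key
  all_goals exact Continuous.intervalIntegrable (by fun_prop) _ _
end

section
/- Let v be a solution of the modified Orr–Sommerfeld equation with wave speed c, not identically zero on [-1,1]. Write U_min = min_{[-1,1]} U, U_max = max_{[-1,1]} U, U''_min = min_{[-1,1]} U'', U''_max = max_{[-1,1]} U''. Then: (i) if U''_min ≥ 0 then U_min ≤ Re(c) ≤ U_max + 2·U''_max/(π² + 4α²); (ii) if U''_min ≤ 0 ≤ U''_max then U_min + 2·U''_min/(π² + 4α²) ≤ Re(c) ≤ U_max + 2·U''_max/(π² + 4α²); (iii) if U''_max ≤ 0 then U_min + 2·U''_min/(π² + 4α²) ≤ Re(c) ≤ U_max. -/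
open Real

open scoped ComplexConjugate

/-- A weighted Poincaré-type uniqueness principle on `[-1,1]`: if the total derivative `G'` dominates
`δ (|v'|² + α² |v|²) - (Q / 2) |v|²` and `δ (k² + α²) > Q / 2` for some `0 ≤ k < π / 2`,
then `v` vanishes. -/
lemma eq_zero_of_hasDerivAt_energy {G G' : ℝ → ℝ} {v v' : ℝ → ℂ} {α δ Q k : ℝ}
    (hv : ∀ y, HasDerivAt v (v' y) y)
    (hG : ∀ y ∈ Set.Icc (-1 : ℝ) 1, HasDerivAt G (G' y) y)
    (hG' : ∀ y ∈ Set.Icc (-1 : ℝ) 1,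
      δ * (Complex.normSq (v' y) + α ^ 2 * Complex.normSq (v y))
        - Q / 2 * Complex.normSq (v y) ≤ G' y)
    (hG₁ : G (-1) = 0) (hG₂ : G 1 = 0) (hv₁ : v (-1) = 0) (hv₂ : v 1 = 0)
    (hδ : 0 < δ) (hk₀ : 0 ≤ k) (hk : k < π / 2) (hQ : Q / 2 < δ * (k ^ 2 + α ^ 2)) :
    ∀ y ∈ Set.Icc (-1 : ℝ) 1, v y = 0 := by
  have hre (y : ℝ) : HasDerivAt (fun z => (v z).re) (v' y).re y :=
    Complex.reCLM.hasFDerivAt.comp_hasDerivAt y (hv y)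
  have him (y : ℝ) : HasDerivAt (fun z => (v z).im) (v' y).im y :=
    Complex.imCLM.hasFDerivAt.comp_hasDerivAt y (hv y)
  set H : ℝ → ℝ := fun y =>
    G y + δ * k * (tan (k * y) * ((v y).re * (v y).re + (v y).im * (v y).im)) with hH
  have hcos : ∀ y ∈ Set.Icc (-1 : ℝ) 1, cos (k * y) ≠ 0 := fun y hy =>
    (cos_pos_of_mem_Ioo ⟨by nlinarith [hy.1, hy.2], by nlinarith [hy.1, hy.2]⟩).ne'
  have hderiv : ∀ y ∈ Set.Icc (-1 : ℝ) 1, ∃ h, HasDerivAt H h y ∧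
      (δ * (k ^ 2 + α ^ 2) - Q / 2) * Complex.normSq (v y) ≤ h := by
    intro y hy
    have hc := hcos y hy
    have htan := (hasDerivAt_tan hc).comp y ((hasDerivAt_id y).const_mul k)
    refine ⟨_, (hG y hy).add ((htan.mul
      (((hre y).mul (hre y)).add ((him y).mul (him y)))).const_mul (δ * k)), ?_⟩
    have hsec : 1 / cos (k * y) ^ 2 = 1 + tan (k * y) ^ 2 := by
      rw [tan_eq_sin_div_cos]
      field_simp
      linarith [sin_sq_add_cos_sq (k * y)]
    have := hG' y hy
    simp only [Complex.normSq_apply, Function.comp_def, hsec, Pi.mul_apply,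
      Pi.add_apply] at this ⊢
    nlinarith [mul_nonneg hδ.le (sq_nonneg ((v' y).re + k * tan (k * y) * (v y).re)),
      mul_nonneg hδ.le (sq_nonneg ((v' y).im + k * tan (k * y) * (v y).im))]
  have hpos : 0 < δ * (k ^ 2 + α ^ 2) - Q / 2 := by linarith
  have hmono : MonotoneOn H (Set.Icc (-1) 1) := by
    refine monotoneOn_of_deriv_nonneg (convex_Icc _ _) ?_ ?_ ?_
    · intro y hy
      obtain ⟨h, h₁, -⟩ := hderiv y hy
      exact h₁.continuousAt.continuousWithinAt
    · intro y hy
      obtain ⟨h, h₁, -⟩ := hderiv y (interior_subset hy)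
      exact h₁.differentiableAt.differentiableWithinAt
    · intro y hy
      obtain ⟨h, h₁, h₂⟩ := hderiv y (interior_subset hy)
      rw [h₁.deriv]
      exact (mul_nonneg hpos.le (Complex.normSq_nonneg _)).trans h₂
  have hH₁ : H (-1) = 0 := by simp [hH, hG₁, hv₁]
  have hH₂ : H 1 = 0 := by simp [hH, hG₂, hv₂]
  have hzero : ∀ y ∈ Set.Icc (-1 : ℝ) 1, H y = 0 := fun y hy => le_antisymm
    (hH₂ ▸ hmono hy (Set.right_mem_Icc.2 (by norm_num)) hy.2)
    (hH₁ ▸ hmono (Set.left_mem_Icc.2 (by norm_num)) hy hy.1)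
  intro y hy
  rcases eq_or_lt_of_le hy.1 with h | hlt₁
  · rw [← h, hv₁]
  rcases eq_or_lt_of_le hy.2 with h | hlt₂
  · rw [h, hv₂]
  obtain ⟨h, h₁, h₂⟩ := hderiv y hy
  have heq : H =ᶠ[nhds y] fun _ => 0 :=
    Filter.eventually_of_mem (Icc_mem_nhds hlt₁ hlt₂) hzero
  have h0 : h = 0 := h₁.unique ((hasDerivAt_const y (0 : ℝ)).congr_of_eventuallyEq heq)
  rw [h0] at h₂
  exact Complex.normSq_eq_zero.1 (le_antisymm (by
    by_contra! hn
    exact absurd h₂ (mul_pos hpos hn).not_ge) (Complex.normSq_nonneg _))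

/-- If `v` is not identically zero, the coefficient `δ` of the energy in a total derivative
satisfies `δ ≤ 2 Q / (π² + 4 α²)` for `Q ≥ 0` and `δ ≤ 0` for `Q ≤ 0`. -/
lemma energy_coefficient_le {G G' : ℝ → ℝ} {v v' : ℝ → ℂ} {α δ Q : ℝ} (hα : 0 < α)
    (hv : ∀ y, HasDerivAt v (v' y) y)
    (hG : ∀ y ∈ Set.Icc (-1 : ℝ) 1, HasDerivAt G (G' y) y)
    (hG' : ∀ y ∈ Set.Icc (-1 : ℝ) 1,
      δ * (Complex.normSq (v' y) + α ^ 2 * Complex.normSq (v y))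
        - Q / 2 * Complex.normSq (v y) ≤ G' y)
    (hG₁ : G (-1) = 0) (hG₂ : G 1 = 0) (hv₁ : v (-1) = 0) (hv₂ : v 1 = 0)
    (hne : ∃ y ∈ Set.Icc (-1 : ℝ) 1, v y ≠ 0) :
    (0 ≤ Q → δ ≤ 2 * Q / (π ^ 2 + 4 * α ^ 2)) ∧ (Q ≤ 0 → δ ≤ 0) := by
  obtain ⟨y₀, hy₀, hvy₀⟩ := hne
  have key (k : ℝ) (hδ : 0 < δ) (hk₀ : 0 ≤ k) (hk : k < π / 2)
      (hQ : Q / 2 < δ * (k ^ 2 + α ^ 2)) : False :=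
    hvy₀ (eq_zero_of_hasDerivAt_energy hv hG hG' hG₁ hG₂ hv₁ hv₂ hδ hk₀ hk hQ y₀ hy₀)
  constructor
  · intro hQ
    by_contra! hlt
    have hD : 0 < π ^ 2 + 4 * α ^ 2 := by positivity
    have hδ : 0 < δ := lt_of_le_of_lt (by positivity) hlt
    rw [div_lt_iff₀ hD] at hlt
    have hcont : Continuous fun k : ℝ => δ * (k ^ 2 + α ^ 2) := by fun_prop
    have hnear : ∀ᶠ k in nhdsWithin (π / 2) (Set.Iio (π / 2)), Q / 2 < δ * (k ^ 2 + α ^ 2) :=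
      nhdsWithin_le_nhds (hcont.continuousAt.eventually (lt_mem_nhds (by nlinarith)))
    obtain ⟨k, hk, hk₀, hk₁⟩ :=
      (hnear.and (Ioo_mem_nhdsLT (show (0 : ℝ) < π / 2 by positivity))).exists
    exact key k hδ hk₀.le hk₁ hk
  · intro hQ
    by_contra! hδ
    exact key 0 hδ le_rfl (by positivity) (by nlinarith [mul_pos hδ (pow_pos hα 2)])

/-- Real part of the derivative of the Orr–Sommerfeld flux: the pointwise algebraic identity
behind the energy balance. Here `a`, `b`, `d` stand for `v`, `v'`, `v''`. -/
lemma orr_sommerfeld_flux_re {α Re u u₁ u₂ m t : ℝ} {c a b d M₁ W₂ : ℂ}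
    (h : (α : ℂ) * c * (d - (α : ℂ) ^ 2 * a)
        = (α : ℂ) * ((u : ℂ) * (d - (α : ℂ) ^ 2 * a) - (u₂ : ℂ) * a)
          - (4 * Complex.I * (α : ℂ) ^ 2 / (Re : ℂ)) * M₁
          + (Complex.I / (Re : ℂ)) *
              (W₂ + (α : ℂ) ^ 2 * (t : ℂ) * (d + (α : ℂ) ^ 2 * a))) :
    (α * c * (d * conj a + b * conj b)
      - α * (u₁ * (b * conj a) + u * (d * conj a + b * conj b))
      + α / 2 * (u₂ * (a * conj a) + u₁ * (b * conj a + a * conj b))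
      + 4 * Complex.I * α ^ 2 / Re * (M₁ * conj a + m * b * conj b)
      - Complex.I / Re * (W₂ * conj a - t * (d + α ^ 2 * a) * conj d)).re
    = α * ((c.re - u) * (Complex.normSq b + α ^ 2 * Complex.normSq a)
        - u₂ / 2 * Complex.normSq a) := by
  have e : α * c * (d * conj a + b * conj b)
      - α * (u₁ * (b * conj a) + u * (d * conj a + b * conj b))
      + α / 2 * (u₂ * (a * conj a) + u₁ * (b * conj a + a * conj b))
      + 4 * Complex.I * α ^ 2 / Re * (M₁ * conj a + m * b * conj b)
      - Complex.I / Re * (W₂ * conj a - t * (d + α ^ 2 * a) * conj d)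
      = α * ((c - u) * (b * conj b + α ^ 2 * (a * conj a)) - u₂ / 2 * (a * conj a))
        + α / 2 * u₁ * (a * conj b - b * conj a)
        + ((4 * α ^ 2 / Re * m : ℝ) : ℂ) * (Complex.I * (b * conj b))
        + ((t / Re : ℝ) : ℂ)
          * (Complex.I * ((d + α ^ 2 * a) * conj (d + (α : ℂ) ^ 2 * a))) := by
    simp only [map_add, map_mul, map_pow, Complex.conj_ofReal]
    push_cast
    linear_combination (conj a) * h
  have e' : α * ((c - u) * (b * conj b + α ^ 2 * (a * conj a)) - u₂ / 2 * (a * conj a))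
        + α / 2 * u₁ * (a * conj b - b * conj a)
      = ((α : ℝ) : ℂ) * ((c - (u : ℂ)) * ((Complex.normSq b + α ^ 2 * Complex.normSq a : ℝ) : ℂ)
          - ((u₂ / 2 * Complex.normSq a : ℝ) : ℂ))
        + ((α / 2 * u₁ : ℝ) : ℂ) * (a * conj b - b * conj a) := by
    simp only [Complex.mul_conj]
    push_cast
    ring
  rw [e, e']
  simp only [Complex.mul_conj, Complex.add_re, Complex.sub_re,
    Complex.ofReal_re, Complex.mul_re, Complex.I_re, Complex.I_im,
    Complex.ofReal_im, Complex.conj_re, Complex.conj_im]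
  ring

/-- **Bounds on the wave speed `Re c` for the modified Orr–Sommerfeld equation**
in terms of the extrema of `U` and `U''` on `[-1,1]`. -/
theorem orr_sommerfeld_real_wave_speed_bounds
    (U μ μt : ℝ → ℝ) (v : ℝ → ℂ) (c : ℂ) (α Re Umin Umax Uppmin Uppmax : ℝ)
    (hU : ContDiff ℝ 2 U) (hμ : ContDiff ℝ 1 μ) (hμt : ContDiff ℝ 2 μt)
    (hv : ContDiff ℝ 4 v)
    (hα : 0 < α) (hRe : 0 < Re)
    (hUmin : IsLeast (U '' Set.Icc (-1 : ℝ) 1) Umin)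
    (hUmax : IsGreatest (U '' Set.Icc (-1 : ℝ) 1) Umax)
    (hUppmin : IsLeast ((deriv (deriv U)) '' Set.Icc (-1 : ℝ) 1) Uppmin)
    (hUppmax : IsGreatest ((deriv (deriv U)) '' Set.Icc (-1 : ℝ) 1) Uppmax)
    (hbc1 : v (-1) = 0) (hbc2 : v 1 = 0)
    (hbc3 : deriv v (-1) = 0) (hbc4 : deriv v 1 = 0)
    (hne : ∃ y ∈ Set.Icc (-1 : ℝ) 1, v y ≠ 0)
    (heq : ∀ y ∈ Set.Icc (-1 : ℝ) 1,
      (α : ℂ) * c * (deriv (deriv v) y - (α : ℂ) ^ 2 * v y)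
        = (α : ℂ) * ((U y : ℂ) * (deriv (deriv v) y - (α : ℂ) ^ 2 * v y)
            - ((deriv (deriv U) y : ℝ) : ℂ) * v y)
          - (4 * Complex.I * (α : ℂ) ^ 2 / (Re : ℂ)) *
              deriv (fun z => ((μ z : ℝ) : ℂ) * deriv v z) y
          + (Complex.I / (Re : ℂ)) *
              (deriv (deriv (fun z => ((μt z : ℝ) : ℂ) *
                  (deriv (deriv v) z + (α : ℂ) ^ 2 * v z))) y
                + (α : ℂ) ^ 2 * ((μt y : ℝ) : ℂ) *
                    (deriv (deriv v) y + (α : ℂ) ^ 2 * v y))) :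
    (0 ≤ Uppmin →
      Umin ≤ c.re ∧ c.re ≤ Umax + 2 * Uppmax / (π ^ 2 + 4 * α ^ 2)) ∧
    (Uppmin ≤ 0 → 0 ≤ Uppmax →
      Umin + 2 * Uppmin / (π ^ 2 + 4 * α ^ 2) ≤ c.re ∧
        c.re ≤ Umax + 2 * Uppmax / (π ^ 2 + 4 * α ^ 2)) ∧
    (Uppmax ≤ 0 →
      Umin + 2 * Uppmin / (π ^ 2 + 4 * α ^ 2) ≤ c.re ∧ c.re ≤ Umax) := by
  have hv₀ (y : ℝ) : HasDerivAt v (deriv v y) y :=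
    (hv.differentiable (by norm_num) y).hasDerivAt
  have hv1 : ContDiff ℝ 3 (deriv v) := hv.deriv' (n := 3)
  have hv2 : ContDiff ℝ 2 (deriv (deriv v)) := hv1.deriv' (n := 2)
  have hv₁ (y : ℝ) : HasDerivAt (deriv v) (deriv (deriv v) y) y :=
    (hv1.differentiable (by norm_num) y).hasDerivAt
  have hU₀ (y : ℝ) : HasDerivAt (fun z => (U z : ℂ)) ((deriv U y : ℝ) : ℂ) y :=
    (hU.differentiable (by norm_num) y).hasDerivAt.ofReal_comp
  have hU1 : ContDiff ℝ 1 (deriv U) := hU.deriv' (n := 1)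
  have hU₁ (y : ℝ) : HasDerivAt (fun z => ((deriv U z : ℝ) : ℂ)) ((deriv (deriv U) y : ℝ) : ℂ) y :=
    (hU1.differentiable (by norm_num) y).hasDerivAt.ofReal_comp
  set M : ℝ → ℂ := fun z => ((μ z : ℝ) : ℂ) * deriv v z with hM_def
  set W : ℝ → ℂ := fun z => ((μt z : ℝ) : ℂ) *
    (deriv (deriv v) z + (α : ℂ) ^ 2 * v z) with hW_def
  have hM : ContDiff ℝ 1 M :=
    (Complex.ofRealCLM.contDiff.comp hμ).mul (hv1.of_le (by norm_num))
  have hW : ContDiff ℝ 2 W :=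
    (Complex.ofRealCLM.contDiff.comp hμt).mul
      (hv2.add (contDiff_const.mul (hv.of_le (by norm_num))))
  have hW1 : ContDiff ℝ 1 (deriv W) := hW.deriv' (n := 1)
  have hM₀ (y : ℝ) : HasDerivAt M (deriv M y) y :=
    (hM.differentiable (by norm_num) y).hasDerivAt
  have hW₀ (y : ℝ) : HasDerivAt W (deriv W y) y :=
    (hW.differentiable (by norm_num) y).hasDerivAt
  have hW₁ (y : ℝ) : HasDerivAt (deriv W) (deriv (deriv W) y) y :=
    (hW1.differentiable (by norm_num) y).hasDerivAt
  have hc₀ (y : ℝ) : HasDerivAt (fun z => conj (v z)) (conj (deriv v y)) y := (hv₀ y).star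
  have hc₁ (y : ℝ) : HasDerivAt (fun z => conj (deriv v z)) (conj (deriv (deriv v) y)) y :=
    (hv₁ y).star
  set F : ℝ → ℂ := fun z => α * c * (deriv v z * conj (v z))
    - α * (U z * (deriv v z * conj (v z))) + α / 2 * (((deriv U z : ℝ) : ℂ) * (v z * conj (v z)))
    + 4 * Complex.I * α ^ 2 / Re * (M z * conj (v z))
    - Complex.I / Re * (deriv W z * conj (v z) - W z * conj (deriv v z)) with hF_def
  have hF : ∀ y ∈ Set.Icc (-1 : ℝ) 1, HasDerivAt (fun z => (F z).re / α)
      ((c.re - U y) * (Complex.normSq (deriv v y) + α ^ 2 * Complex.normSq (v y))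
        - deriv (deriv U) y / 2 * Complex.normSq (v y)) y := by
    intro y hy
    have hvc := (hv₁ y).mul (hc₀ y)
    have hd := ((((hvc.const_mul (α * c)).sub (((hU₀ y).mul hvc).const_mul (α : ℂ))).add
      (((hU₁ y).mul ((hv₀ y).mul (hc₀ y))).const_mul (α / 2 : ℂ))).add
      (((hM₀ y).mul (hc₀ y)).const_mul (4 * Complex.I * α ^ 2 / Re : ℂ))).sub
      ((((hW₁ y).mul (hc₀ y)).sub ((hW₀ y).mul (hc₁ y))).const_mul (Complex.I / Re : ℂ))
    have hre := (Complex.reCLM.hasFDerivAt.comp_hasDerivAt y hd).div_const α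
    refine hre.congr_deriv ?_
    rw [div_eq_iff hα.ne', mul_comm _ α, ← orr_sommerfeld_flux_re (u₁ := deriv U y) (m := μ y)
      (heq y hy)]
    simp only [Complex.reCLM_apply, hM_def, hW_def, Pi.mul_apply]
    congr 1
    ring
  have hF₁ : (F (-1)).re / α = 0 := by simp [hF_def, hbc1, hbc3]
  have hF₂ : (F 1).re / α = 0 := by simp [hF_def, hbc2, hbc4]
  have henergy (y : ℝ) : 0 ≤ Complex.normSq (deriv v y) + α ^ 2 * Complex.normSq (v y) :=
    add_nonneg (Complex.normSq_nonneg _) (mul_nonneg (sq_nonneg _) (Complex.normSq_nonneg _))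
  have upper := energy_coefficient_le (δ := c.re - Umax) (Q := Uppmax) hα hv₀ hF (by
    intro y hy
    have h₁ := hUmax.2 (Set.mem_image_of_mem U hy)
    have h₂ := hUppmax.2 (Set.mem_image_of_mem (deriv (deriv U)) hy)
    have := mul_le_mul_of_nonneg_right (sub_le_sub_left h₁ c.re) (henergy y)
    have := mul_le_mul_of_nonneg_right h₂ (Complex.normSq_nonneg (v y))
    linarith) hF₁ hF₂ hbc1 hbc2 hne
  have lower := energy_coefficient_le (δ := Umin - c.re) (Q := -Uppmin) hα hv₀
    (fun y hy => (hF y hy).neg) (by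
    intro y hy
    have h₁ := hUmin.2 (Set.mem_image_of_mem U hy)
    have h₂ := hUppmin.2 (Set.mem_image_of_mem (deriv (deriv U)) hy)
    have := mul_le_mul_of_nonneg_right (sub_le_sub_right h₁ c.re) (henergy y)
    have := mul_le_mul_of_nonneg_right h₂ (Complex.normSq_nonneg (v y))
    linarith) (by simp [hF₁]) (by simp [hF₂]) hbc1 hbc2 hne
  have hle : Uppmin ≤ Uppmax := hUppmin.2 hUppmax.1
  have hneg : 2 * -Uppmin / (π ^ 2 + 4 * α ^ 2) = -(2 * Uppmin / (π ^ 2 + 4 * α ^ 2)) := by ring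
  rw [hneg] at lower
  refine ⟨fun h => ⟨?_, ?_⟩, fun h₁ h₂ => ⟨?_, ?_⟩, fun h => ⟨?_, ?_⟩⟩
  · linarith [lower.2 (by linarith)]
  · linarith [upper.1 (h.trans hle)]
  · linarith [lower.1 (by linarith)]
  · linarith [upper.1 h₂]
  · linarith [lower.1 (by linarith)]
  · linarith [upper.2 h]
end

section
/- If φ is not identically zero on [-1,1] and solves the one-dimensional eigenvalue problem with frequency ω, then Im(ω) ≤ −p·π²/Re; in particular one-dimensional perturbations of the regularized (generalized Newtonian) plane Poiseuille flow are always linearly stable. -/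
open Real

open MeasureTheory Set intervalIntegral
open scoped ComplexConjugate

/-- **Wirtinger's inequality** for a complex function with mean zero and equal values at the
endpoints of `[a, b]`. -/
theorem wirtinger_inequality {a b : ℝ} (hab : a < b) {f f' : ℝ → ℂ}
    (hf : ∀ x ∈ uIcc a b, HasDerivAt f (f' x) x) (hf' : ContinuousOn f' (Icc a b))
    (hper : f a = f b) (hmean : ∫ x in a..b, f x = 0) :
    (2 * π / (b - a)) ^ 2 * ∫ x in a..b, ‖f x‖ ^ 2 ≤ ∫ x in a..b, ‖f' x‖ ^ 2 := by
  have hba : 0 < b - a := sub_pos.2 hab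
  have memLp {g : ℝ → ℂ} (hg : ContinuousOn g (Icc a b)) :
      MemLp g 2 (volume.restrict (Ioc a b)) := by
    obtain ⟨C, hC⟩ := isCompact_Icc.exists_bound_of_continuousOn hg
    refine .of_bound ((hg.mono Ioc_subset_Icc_self).aestronglyMeasurable measurableSet_Ioc) C ?_
    exact (ae_restrict_mem measurableSet_Ioc).mono fun x hx ↦ hC x (Ioc_subset_Icc_self hx)
  have hfc : ContinuousOn f (Icc a b) := fun x hx ↦
    (hf x (Icc_subset_uIcc hx)).continuousAt.continuousWithinAt
  have key (n : ℤ) : (2 * π / (b - a)) ^ 2 * ‖fourierCoeffOn hab f n‖ ^ 2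
      ≤ ‖fourierCoeffOn hab f' n‖ ^ 2 := by
    rcases eq_or_ne n 0 with rfl | hn
    · have h0 : fourierCoeffOn hab f 0 = 0 := by
        simp [fourierCoeffOn_eq_integral, hmean]
      simp [h0]
    · have hn1 : (1 : ℝ) ≤ |(n : ℝ)| := by exact_mod_cast Int.one_le_abs hn
      have hc := fourierCoeffOn_of_hasDerivAt hab hn hf
        (hf'.intervalIntegrable_of_Icc hab.le)
      have hnC : (n : ℂ) ≠ 0 := by exact_mod_cast hn
      have hpC : (π : ℂ) ≠ 0 := by exact_mod_cast pi_ne_zero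
      have hbC : ((b - a : ℝ) : ℂ) ≠ 0 := by exact_mod_cast hba.ne'
      have hc' : fourierCoeffOn hab f' n
          = ((2 * π / (b - a) : ℝ) : ℂ) * Complex.I * n * fourierCoeffOn hab f n := by
        rw [hc, hper]
        push_cast at hbC ⊢
        field_simp
        ring_nf
      rw [hc']
      simp only [norm_mul, Complex.norm_real, Complex.norm_I, Complex.norm_intCast, mul_one,
        mul_pow, norm_eq_abs, sq_abs]
      have hn2 : (1 : ℝ) ≤ (n : ℝ) ^ 2 := by
        rw [← sq_abs]; nlinarith
      gcongr
      exact le_mul_of_one_le_right (by positivity) hn2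
  have h := hasSum_le key ((hasSum_sq_fourierCoeffOn hab (memLp hfc)).mul_left _)
    (hasSum_sq_fourierCoeffOn hab (memLp hf'))
  rw [smul_eq_mul, smul_eq_mul, mul_left_comm] at h
  exact le_of_mul_le_mul_left h (inv_pos.2 hba)

/-- Integration by parts against the conjugate of a function vanishing at both endpoints. -/
theorem integral_mul_conj_deriv {a b : ℝ} {u v u' v' : ℝ → ℂ}
    (hu : ∀ x, HasDerivAt u (u' x) x) (hv : ∀ x, HasDerivAt v (v' x) x)
    (hu' : Continuous u') (hv' : Continuous v') (ha : v a = 0) (hb : v b = 0) :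
    ∫ x in a..b, u' x * conj (v x) = -∫ x in a..b, u x * conj (v' x) := by
  have h := integral_mul_deriv_eq_deriv_mul (a := a) (b := b) (fun x _ ↦ hu x)
    (fun x _ ↦ (hv x).star) (hu'.intervalIntegrable _ _)
    (hv'.star.intervalIntegrable _ _)
  simp only [ha, hb, star_zero, mul_zero, sub_zero, zero_sub] at h
  exact neg_eq_iff_eq_neg.1 h.symm

/-- **One-dimensional stability of the regularized (generalized Newtonian) flow:**
if `φ`, not identically zero on `[-1,1]`, solves
`ω φ'' = (i/Re)(μt φ'')''` with clamped boundary conditions, then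
`Im ω ≤ −p π²/Re`; in particular one-dimensional perturbations are always
linearly stable. -/
theorem one_dimensional_stability_regularized
    (μt : ℝ → ℝ) (φ : ℝ → ℂ) (ω : ℂ) (Re p : ℝ)
    (hμt : ContDiff ℝ 2 μt)
    (hp : IsLeast (μt '' Set.Icc (-1 : ℝ) 1) p) (hppos : 0 < p)
    (hRe : 0 < Re)
    (hφ : ContDiff ℝ 4 φ)
    (hbc1 : φ (-1) = 0) (hbc2 : φ 1 = 0)
    (hbc3 : deriv φ (-1) = 0) (hbc4 : deriv φ 1 = 0)
    (hne : ∃ y ∈ Set.Icc (-1 : ℝ) 1, φ y ≠ 0)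
    (heq : ∀ y ∈ Set.Icc (-1 : ℝ) 1,
      ω * deriv (deriv φ) y
        = (Complex.I / (Re : ℂ)) *
            deriv (deriv (fun z => ((μt z : ℝ) : ℂ) * deriv (deriv φ) z)) y) :
    ω.im ≤ -p * π ^ 2 / Re := by
  have hasDeriv {g : ℝ → ℂ} {n : ℕ} (hg : ContDiff ℝ (n + 1 : ℕ) g) :
      ContDiff ℝ n (deriv g) ∧ ∀ x, HasDerivAt g (deriv g x) x := by
    refine ⟨?_, fun x ↦ (hg.differentiable (by simp) x).hasDerivAt⟩
    have : ContDiff ℝ ((n : WithTop ℕ∞) + 1) g := by exact_mod_cast hg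
    exact (contDiff_succ_iff_deriv.1 this).2.2
  obtain ⟨hφ₁, dφ⟩ := hasDeriv (n := 3) (by exact_mod_cast hφ)
  obtain ⟨hφ₂, dφ₁⟩ := hasDeriv (n := 2) hφ₁
  set A := deriv φ with hA
  set B := deriv A with hB
  set w : ℝ → ℂ := fun z ↦ (μt z : ℂ) * B z with hw
  have hwC : ContDiff ℝ 2 w :=
    (Complex.ofRealCLM.contDiff.comp hμt).mul (by exact_mod_cast hφ₂)
  obtain ⟨hw₁, dw⟩ := hasDeriv (n := 1) (by exact_mod_cast hwC)
  obtain ⟨hw₂, dw₁⟩ := hasDeriv (n := 0) hw₁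
  have cA : Continuous A := hφ₁.continuous
  have cB : Continuous B := hφ₂.continuous
  have cμ : Continuous μt := hμt.continuous
  have hleft : ∫ y in (-1 : ℝ)..1, B y * conj (φ y)
      = -((∫ y in (-1 : ℝ)..1, ‖A y‖ ^ 2 : ℝ) : ℂ) := by
    rw [integral_mul_conj_deriv dφ₁ dφ cB cA hbc1 hbc2, ← intervalIntegral.integral_ofReal]
    simp [Complex.mul_conj']
  have hright : ∫ y in (-1 : ℝ)..1, deriv (deriv w) y * conj (φ y)
      = ((∫ y in (-1 : ℝ)..1, μt y * ‖B y‖ ^ 2 : ℝ) : ℂ) := by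
    rw [integral_mul_conj_deriv dw₁ dφ hw₂.continuous cA hbc1 hbc2,
      integral_mul_conj_deriv dw dφ₁ hw₁.continuous cB hbc3 hbc4, neg_neg,
      ← intervalIntegral.integral_ofReal]
    simp [hw, mul_assoc, Complex.mul_conj']
  have henergy : ω * ∫ y in (-1 : ℝ)..1, B y * conj (φ y)
      = Complex.I / Re * ∫ y in (-1 : ℝ)..1, deriv (deriv w) y * conj (φ y) := by
    rw [← intervalIntegral.integral_const_mul, ← intervalIntegral.integral_const_mul]
    refine intervalIntegral.integral_congr fun y hy ↦ ?_
    rw [uIcc_of_le (by norm_num)] at hy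
    simp only [← mul_assoc, heq y hy]
  rw [hleft, hright] at henergy
  have him : -(ω.im * ∫ y in (-1 : ℝ)..1, ‖A y‖ ^ 2)
      = (∫ y in (-1 : ℝ)..1, μt y * ‖B y‖ ^ 2) / Re := by
    have h : Complex.I / (Re : ℂ) = ((Re⁻¹ : ℝ) : ℂ) * Complex.I := by
      push_cast; ring
    rw [h] at henergy
    have := congrArg Complex.im henergy
    simp only [mul_neg, Complex.neg_im, Complex.im_mul_ofReal, Complex.im_ofReal_mul,
      Complex.I_im, mul_one] at this
    rw [this]; ring
  have hFTC (y : ℝ) : ∫ x in (-1 : ℝ)..y, A x = φ y := by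
    rw [integral_eq_sub_of_hasDerivAt (fun x _ ↦ dφ x) (cA.intervalIntegrable _ _), hbc1,
      sub_zero]
  have hpos : 0 < ∫ y in (-1 : ℝ)..1, ‖A y‖ ^ 2 := by
    refine intervalIntegral.integral_pos (by norm_num) (by fun_prop)
      (fun _ _ ↦ by positivity) ?_
    by_contra! hzero
    obtain ⟨y, hy, hφy⟩ := hne
    refine hφy ?_
    rw [← hFTC y]
    refine (intervalIntegral.integral_congr fun x hx ↦ ?_).trans intervalIntegral.integral_zero
    rw [uIcc_of_le hy.1] at hx
    simpa using (hzero x ⟨hx.1, hx.2.trans hy.2⟩).antisymm (by positivity)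
  have hwirt : π ^ 2 * ∫ y in (-1 : ℝ)..1, ‖A y‖ ^ 2 ≤ ∫ y in (-1 : ℝ)..1, ‖B y‖ ^ 2 := by
    have h := wirtinger_inequality (by norm_num : (-1 : ℝ) < 1) (fun x _ ↦ dφ₁ x)
      cB.continuousOn (hbc3.trans hbc4.symm) ((hFTC 1).trans hbc2)
    have h2 : 2 * π / (1 - -1) = π := by ring
    rwa [h2] at h
  have hvisc : p * ∫ y in (-1 : ℝ)..1, ‖B y‖ ^ 2 ≤ ∫ y in (-1 : ℝ)..1, μt y * ‖B y‖ ^ 2 := by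
    rw [← intervalIntegral.integral_const_mul]
    refine intervalIntegral.integral_mono_on (by norm_num)
      (Continuous.intervalIntegrable (by fun_prop) _ _)
      (Continuous.intervalIntegrable (by fun_prop) _ _) fun y hy ↦ ?_
    exact mul_le_mul_of_nonneg_right (hp.2 (mem_image_of_mem _ hy)) (by positivity)
  rw [eq_div_iff hRe.ne'] at him
  rw [le_div_iff₀ hRe]
  refine le_of_mul_le_mul_right ?_ hpos
  nlinarith [mul_le_mul_of_nonneg_left hwirt hppos.le]
end

section
/- If φ is not identically zero on [-1,1], then Im(ω) < 0; i.e. plane Poiseuille flow of the elastoviscoplastic fluid is linearly stable to one-dimensional perturbations. -/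
open Real

/-- If `τ` and `z` are related by `(1 - i ε R p m ω) τ = t z` with nonnegative `ε, R, p, m`, positive
`t` and `0 ≤ Im ω`, then `τ z̄` has nonnegative real part. -/
lemma re_mul_star_nonneg_of_constitutive {ε R p m t : ℝ} {ω τ z : ℂ}
    (hε : 0 ≤ ε) (hR : 0 ≤ R) (hp : 0 ≤ p) (hm : 0 ≤ m) (ht : 0 < t) (hω : 0 ≤ ω.im)
    (h : (1 - Complex.I * (ε : ℂ) * (R : ℂ) * (p : ℂ) * (m : ℂ) * ω) * τ = (t : ℂ) * z) :
    0 ≤ (τ * star z).re := by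
  have key : t * (τ * star z).re
      = (1 + ε * R * p * m * ω.im) * (τ.re ^ 2 + τ.im ^ 2) := by
    have h1 := congrArg Complex.re h
    have h2 := congrArg Complex.im h
    simp at h1 h2 ⊢
    linear_combination (-τ.re) * h1 - τ.im * h2
  have hpos : 0 ≤ t * (τ * star z).re := by rw [key]; positivity
  exact nonneg_of_mul_nonneg_right hpos ht

/-- A function on `[a, b]` with nonpositive derivative and equal endpoint values has zero
derivative throughout `[a, b]`. -/
lemma hasDerivAt_eq_zero_of_nonpos_of_eq {a b : ℝ} (hab : a < b) {g g' : ℝ → ℝ}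
    (hg : ∀ y, HasDerivAt g (g' y) y) (hg' : ∀ y ∈ Set.Icc a b, g' y ≤ 0) (heq : g a = g b) :
    ∀ y ∈ Set.Icc a b, g' y = 0 := by
  have hanti : AntitoneOn g (Set.Icc a b) := by
    refine antitoneOn_of_deriv_nonpos (convex_Icc a b)
      (fun y _ => (hg y).continuousAt.continuousWithinAt)
      (fun y _ => (hg y).differentiableAt.differentiableWithinAt) fun y hy => ?_
    rw [(hg y).deriv]
    exact hg' y (interior_subset hy)
  have hconst : ∀ y ∈ Set.Icc a b, g y = g a := fun y hy =>
    le_antisymm (hanti (Set.left_mem_Icc.2 hab.le) hy hy.1)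
      (heq ▸ hanti hy (Set.right_mem_Icc.2 hab.le) hy.2)
  intro y hy
  exact (uniqueDiffOn_Icc hab y hy).eq_deriv _ (hg y).hasDerivWithinAt
    ((hasDerivWithinAt_const y _ (g a)).congr hconst (hconst y hy))

/-- A function vanishing at `a` whose derivative vanishes on `[a, b]` is zero on `[a, b]`. -/
lemma eq_zero_of_hasDerivAt_zero {a b : ℝ} {f f' : ℝ → ℂ}
    (hf : ∀ y, HasDerivAt f (f' y) y) (hf' : ∀ y ∈ Set.Icc a b, f' y = 0) (ha : f a = 0) :
    ∀ y ∈ Set.Icc a b, f y = 0 := by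
  intro y hy
  rw [← ha]
  refine constant_of_has_deriv_right_zero (fun x _ => (hf x).continuousAt.continuousWithinAt)
    (fun x hx => ?_) y hy
  rw [← hf' x ⟨hx.1, hx.2.le⟩]
  exact (hf x).hasDerivWithinAt

/-- **One-dimensional linear stability of the elastoviscoplastic flow:**
if `φ`, not identically zero on `[-1,1]`, solves (together with `τ`) the
one-dimensional linearized elastoviscoplastic equations
`τ'' = −i Re ω φ'' − μᵣ φ''''` and `(1 − i εℓ Re Φ μ ω) τ = μt φ''`
with clamped boundary conditions, then `Im ω < 0`. -/
theorem elastoviscoplastic_one_dimensional_stability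
    (Φ μ μt : ℝ → ℝ) (φ τ : ℝ → ℂ) (ω : ℂ) (Re μr εl : ℝ)
    (hRe : 0 < Re) (hμr : 0 < μr) (hεl : 0 ≤ εl)
    (hΦcont : ContinuousOn Φ (Set.Icc (-1 : ℝ) 1))
    (hμcont : ContinuousOn μ (Set.Icc (-1 : ℝ) 1))
    (hμtcont : ContinuousOn μt (Set.Icc (-1 : ℝ) 1))
    (hΦpos : ∀ y ∈ Set.Icc (-1 : ℝ) 1, 0 ≤ Φ y)
    (hμpos : ∀ y ∈ Set.Icc (-1 : ℝ) 1, 0 ≤ μ y)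
    (hμtpos : ∀ y ∈ Set.Icc (-1 : ℝ) 1, 0 < μt y)
    (hφ : ContDiff ℝ 4 φ) (hτ : ContDiff ℝ 2 τ)
    (hbc1 : φ (-1) = 0) (hbc2 : φ 1 = 0)
    (hbc3 : deriv φ (-1) = 0) (hbc4 : deriv φ 1 = 0)
    (hne : ∃ y ∈ Set.Icc (-1 : ℝ) 1, φ y ≠ 0)
    (heq1 : ∀ y ∈ Set.Icc (-1 : ℝ) 1,
      deriv (deriv τ) y
        = -Complex.I * (Re : ℂ) * ω * deriv (deriv φ) y
          - (μr : ℂ) * deriv (deriv (deriv (deriv φ))) y)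
    (heq2 : ∀ y ∈ Set.Icc (-1 : ℝ) 1,
      (1 - Complex.I * (εl : ℂ) * (Re : ℂ) * ((Φ y : ℝ) : ℂ) * ((μ y : ℝ) : ℂ) * ω) * τ y
        = ((μt y : ℝ) : ℂ) * deriv (deriv φ) y) :
    ω.im < 0 := by
  by_contra! hω
  have hφ3 : ContDiff ℝ 3 (deriv φ) := ContDiff.deriv' (n := 3) hφ
  have hφ2 : ContDiff ℝ 2 (deriv (deriv φ)) := ContDiff.deriv' (n := 2) hφ3
  have hφ1 : ContDiff ℝ 1 (deriv (deriv (deriv φ))) := ContDiff.deriv' (n := 1) hφ2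
  have hτ1 : ContDiff ℝ 1 (deriv τ) := ContDiff.deriv' (n := 1) hτ
  have d0 (y) : HasDerivAt φ (deriv φ y) y := (hφ.differentiable (by norm_num) y).hasDerivAt
  have d1 (y) : HasDerivAt (deriv φ) (deriv (deriv φ) y) y :=
    (hφ3.differentiable (by norm_num) y).hasDerivAt
  have d2 (y) : HasDerivAt (deriv (deriv φ)) (deriv (deriv (deriv φ)) y) y :=
    (hφ2.differentiable (by norm_num) y).hasDerivAt
  have d3 (y) : HasDerivAt (deriv (deriv (deriv φ))) (deriv (deriv (deriv (deriv φ))) y) y :=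
    (hφ1.differentiable (by norm_num) y).hasDerivAt
  have e0 (y) : HasDerivAt τ (deriv τ y) y := (hτ.differentiable (by norm_num) y).hasDerivAt
  have e1 (y) : HasDerivAt (deriv τ) (deriv (deriv τ) y) y :=
    (hτ1.differentiable (by norm_num) y).hasDerivAt
  -- The boundary terms of the energy identity, collected into one function.
  let G : ℝ → ℂ := fun y =>
    deriv τ y * star (φ y) - τ y * star (deriv φ y)
      + Complex.I * (Re : ℂ) * ω * (deriv φ y * star (φ y))
      + (μr : ℂ) * (deriv (deriv (deriv φ)) y * star (φ y)
        - deriv (deriv φ) y * star (deriv φ y))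
  let E : ℝ → ℝ := fun y => -(τ y * star (deriv (deriv φ) y)).re
      - Re * ω.im * Complex.normSq (deriv φ y) - μr * Complex.normSq (deriv (deriv φ) y)
  let D : ℝ → ℂ := fun y =>
    deriv (deriv τ) y * star (φ y) + deriv τ y * star (deriv φ y)
      - (deriv τ y * star (deriv φ y) + τ y * star (deriv (deriv φ) y))
      + Complex.I * (Re : ℂ) * ω
        * (deriv (deriv φ) y * star (φ y) + deriv φ y * star (deriv φ y))
      + (μr : ℂ) * (deriv (deriv (deriv (deriv φ))) y * star (φ y)
          + deriv (deriv (deriv φ)) y * star (deriv φ y)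
        - (deriv (deriv (deriv φ)) y * star (deriv φ y)
          + deriv (deriv φ) y * star (deriv (deriv φ) y)))
  have hG (y) : HasDerivAt G (D y) y :=
    ((((e1 y).mul (d0 y).star).sub ((e0 y).mul (d1 y).star)).add
      (((d1 y).mul (d0 y).star).const_mul (Complex.I * (Re : ℂ) * ω))).add
      ((((d3 y).mul (d0 y).star).sub ((d2 y).mul (d1 y).star)).const_mul (μr : ℂ))
  have hg (y) : HasDerivAt (fun y => (G y).re) (D y).re y :=
    Complex.reCLM.hasFDerivAt.comp_hasDerivAt y (hG y)
  have hval : ∀ y ∈ Set.Icc (-1 : ℝ) 1, (D y).re = E y := fun y hy => by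
    have hD : D y = -(τ y * star (deriv (deriv φ) y))
        + Complex.I * (Re : ℂ) * ω * (deriv φ y * star (deriv φ y))
        - (μr : ℂ) * (deriv (deriv φ) y * star (deriv (deriv φ) y)) := by
      simp only [D]
      rw [heq1 y hy]
      ring
    rw [hD]
    simp [E, Complex.normSq_apply]
    ring
  have hτφ : ∀ y ∈ Set.Icc (-1 : ℝ) 1, 0 ≤ (τ y * star (deriv (deriv φ) y)).re :=
    fun y hy => re_mul_star_nonneg_of_constitutive hεl hRe.le (hΦpos y hy) (hμpos y hy)
      (hμtpos y hy) hω (heq2 y hy)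
  have hnn (z : ℂ) : 0 ≤ Re * ω.im * Complex.normSq z :=
    mul_nonneg (mul_nonneg hRe.le hω) (Complex.normSq_nonneg z)
  have hmn (z : ℂ) : 0 ≤ μr * Complex.normSq z := mul_nonneg hμr.le (Complex.normSq_nonneg z)
  have hzero := hasDerivAt_eq_zero_of_nonpos_of_eq (by norm_num : (-1 : ℝ) < 1) hg
    (fun y hy => (hval y hy).trans_le
      (by simp only [E]; linarith [hτφ y hy, hnn (deriv φ y), hmn (deriv (deriv φ) y)]))
    (by simp [G, hbc1, hbc2, hbc3, hbc4])
  have hφ'' : ∀ y ∈ Set.Icc (-1 : ℝ) 1, deriv (deriv φ) y = 0 := fun y hy => by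
    have h := (hval y hy).symm.trans (hzero y hy)
    simp only [E] at h
    have h0 : μr * Complex.normSq (deriv (deriv φ) y) = 0 := by
      linarith [hτφ y hy, hnn (deriv φ y), hmn (deriv (deriv φ) y)]
    exact Complex.normSq_eq_zero.1 ((mul_eq_zero.1 h0).resolve_left hμr.ne')
  obtain ⟨y, hy, hy0⟩ := hne
  exact hy0 (eq_zero_of_hasDerivAt_zero d0 (eq_zero_of_hasDerivAt_zero d1 hφ'' hbc3) hbc1 y hy)
end
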